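/- arXiv:1711.01172 — 2 statements merged into one kernel-verified Lean document; each statement's English description precedes it below -/
import Mathlib

section
/- Let d ≥ 1 be an integer and let ψ ∈ C_c^∞(ℝ) with supp ψ ⊆ {r : 1 ≤ r ≤ 2}. Then there exists a constant C > 0 (depending only on d and ψ) such that for every h > 0, every t ∈ ℝ \ {0} and every x ∈ ℝ^d, the oscillatory integral satisfies |∫_{ℝ^d} e^{i(x·ξ + t|ξ|)} ψ(h|ξ|) dξ| ≤ C h^{−d} min{1, (h/|t|)^{(d−1)/2}}. -/
open MeasureTheory
open scoped RealInnerProductSpace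

open scoped FourierTransform SchwartzMap ContDiff

/-- The integrand `a(r) (1 - 2σr)^{-k} e^{it(r - σr²)}`; the class of these functions is stable under
integration by parts against the phase `r - σr²`. -/
noncomputable def quadraticPhaseIntegrand (a : ℝ → ℝ) (k : ℕ) (t σ r : ℝ) : ℂ :=
  (a r : ℂ) * ((((1 - 2 * σ * r) ^ k)⁻¹ : ℝ) : ℂ) *
    Complex.exp (Complex.I * ((t * (r - σ * r ^ 2) : ℝ) : ℂ))

lemma quarter_le_one_sub {σ r : ℝ} (hσ : |σ| ≤ 1 / 8) (hr : r ∈ Set.Icc (1 / 2 : ℝ) 3) :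
    1 / 4 ≤ 1 - 2 * σ * r := by
  obtain ⟨h1, h2⟩ := abs_le.1 hσ
  nlinarith [hr.1, hr.2]

lemma continuousOn_quadraticPhaseIntegrand {a : ℝ → ℝ} (ha : Continuous a) (k : ℕ) (t : ℝ) {σ : ℝ}
    (hσ : |σ| ≤ 1 / 8) :
    ContinuousOn (quadraticPhaseIntegrand a k t σ) (Set.uIcc (1 / 2 : ℝ) 3) := by
  rw [Set.uIcc_of_le (by norm_num)]
  refine ContinuousOn.mul (ContinuousOn.mul (by fun_prop) ?_) (by fun_prop)
  refine Complex.continuous_ofReal.comp_continuousOn (ContinuousOn.inv₀ (by fun_prop) ?_)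
  intro r hr
  have := quarter_le_one_sub hσ hr
  positivity

lemma hasDerivAt_quadraticPhaseIntegrand {a : ℝ → ℝ} (ha : Differentiable ℝ a) (k : ℕ) (t : ℝ)
    {σ r : ℝ} (h : 1 - 2 * σ * r ≠ 0) :
    HasDerivAt (quadraticPhaseIntegrand a (k + 1) t σ)
      (quadraticPhaseIntegrand (deriv a) (k + 1) t σ r
        + (2 * (k + 1) * σ : ℝ) * quadraticPhaseIntegrand a (k + 2) t σ r
        + Complex.I * t * quadraticPhaseIntegrand a k t σ r) r := by
  have h1 : HasDerivAt a (deriv a r) r := (ha r).hasDerivAt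
  have h2 : HasDerivAt (fun r : ℝ => 1 - 2 * σ * r) (-(2 * σ)) r := by
    simpa using ((hasDerivAt_id r).const_mul (2 * σ)).const_sub 1
  have h3 := (h2.fun_pow (k + 1)).fun_inv (pow_ne_zero _ h)
  have h4 : HasDerivAt (fun r : ℝ => t * (r - σ * r ^ 2)) (t * (1 - σ * (2 * r))) r := by
    simpa using ((hasDerivAt_id r).sub (((hasDerivAt_id r).pow 2).const_mul σ)).const_mul t
  have h5 := (h1.ofReal_comp.mul h3.ofReal_comp).mul ((h4.ofReal_comp.const_mul Complex.I).cexp)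
  refine h5.congr_deriv ?_
  have h' : (1 - 2 * σ * r : ℂ) ≠ 0 := by exact_mod_cast h
  simp only [quadraticPhaseIntegrand, Pi.mul_apply]
  push_cast
  generalize Complex.exp _ = e
  field_simp
  ring

lemma exists_norm_integral_quadraticPhaseIntegrand_le (n : ℕ) :
    ∀ a : ℝ → ℝ, ContDiff ℝ ∞ a → Function.support a ⊆ Set.Icc 1 2 → ∀ k : ℕ,
      ∃ C : ℝ, 0 ≤ C ∧ ∀ t σ : ℝ, t ≠ 0 → |σ| ≤ 1 / 8 →
        ‖∫ r in (1 / 2 : ℝ)..3, quadraticPhaseIntegrand a k t σ r‖ ≤ C / |t| ^ n := by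
  induction n with
  | zero =>
    intro a ha _ k
    obtain ⟨M, hM⟩ := (isCompact_Icc (a := (1 / 2 : ℝ)) (b := 3)).exists_bound_of_continuousOn
      ha.continuous.continuousOn
    have hM0 : 0 ≤ M := (norm_nonneg _).trans (hM 1 (by norm_num))
    refine ⟨M * 4 ^ k * |3 - 1 / 2|, by positivity, fun t σ _ hσ => ?_⟩
    rw [pow_zero, div_one]
    refine intervalIntegral.norm_integral_le_of_norm_le_const fun r hr => ?_
    rw [Set.uIoc_of_le (by norm_num)] at hr
    have hr' := Set.Ioc_subset_Icc_self hr
    have hw := quarter_le_one_sub hσ hr'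
    rw [quadraticPhaseIntegrand, mul_comm Complex.I, norm_mul, norm_mul,
      Complex.norm_exp_ofReal_mul_I, mul_one, Complex.norm_real, Complex.norm_real]
    gcongr
    · exact hM r hr'
    · rw [norm_inv, norm_pow, Real.norm_of_nonneg (by linarith), ← inv_pow]
      gcongr
      rw [inv_le_comm₀ (by linarith) (by norm_num)]
      linarith
  | succ n ih =>
    intro a ha hsupp k
    have hd : ContDiff ℝ ∞ (deriv a) := (contDiff_infty_iff_deriv.1 ha).2
    have hdsupp : Function.support (deriv a) ⊆ Set.Icc 1 2 :=
      support_deriv_subset.trans (closure_minimal hsupp isClosed_Icc)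
    obtain ⟨C₁, hC₁, h₁⟩ := ih (deriv a) hd hdsupp (k + 1)
    obtain ⟨C₂, hC₂, h₂⟩ := ih a ha hsupp (k + 2)
    refine ⟨C₁ + (2 * (k + 1)) * C₂, by positivity, fun t σ ht hσ => ?_⟩
    have hint : ∀ {b : ℝ → ℝ} (j : ℕ), Continuous b →
        IntervalIntegrable (quadraticPhaseIntegrand b j t σ) volume (1 / 2) 3 :=
      fun j hb => (continuousOn_quadraticPhaseIntegrand hb j t hσ).intervalIntegrable
    have hendpoint : ∀ r : ℝ, r ∉ Set.Icc (1 : ℝ) 2 →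
        quadraticPhaseIntegrand a (k + 1) t σ r = 0 := fun r hr => by
      have : a r = 0 := by_contra fun h => hr (hsupp h)
      simp [quadraticPhaseIntegrand, this]
    have i1 := hint (k + 1) hd.continuous
    have i2 := (hint (k + 2) ha.continuous).const_mul ((2 * (k + 1) * σ : ℝ) : ℂ)
    have i3 := (hint k ha.continuous).const_mul (Complex.I * t)
    have key := intervalIntegral.integral_eq_sub_of_hasDerivAt (a := 1 / 2) (b := 3)
      (fun r hr => hasDerivAt_quadraticPhaseIntegrand (ha.differentiable (by simp)) k t (σ := σ) (by
        rw [Set.uIcc_of_le (by norm_num)] at hr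
        linarith [quarter_le_one_sub hσ hr])) ((i1.add i2).add i3)
    rw [hendpoint 3 (by norm_num), hendpoint (1 / 2) (by norm_num), sub_zero,
      intervalIntegral.integral_add (i1.add i2) i3, intervalIntegral.integral_add i1 i2,
      intervalIntegral.integral_const_mul, intervalIntegral.integral_const_mul] at key
    have key' := congrArg norm (eq_neg_of_add_eq_zero_right key)
    rw [norm_neg, norm_mul, norm_mul, Complex.norm_I, one_mul, Complex.norm_real,
      Real.norm_eq_abs] at key'
    have ht' : 0 < |t| := abs_pos.2 ht
    rw [pow_succ, ← div_div, le_div_iff₀ ht', mul_comm, key', add_div]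
    refine (norm_add_le _ _).trans (add_le_add (h₁ t σ ht hσ) ?_)
    rw [norm_mul, mul_div_assoc, Complex.norm_real, norm_mul, Real.norm_of_nonneg (by positivity)]
    have hσ1 : ‖σ‖ ≤ 1 := by rw [Real.norm_eq_abs]; linarith
    exact mul_le_mul (mul_le_of_le_one_right (by positivity) hσ1) (h₂ t σ ht hσ) (norm_nonneg _)
      (by positivity)

section Gaussian

variable {d : ℕ}

lemma sq_norm_integral_cexp_neg_mul_sq_norm_add_le {b : ℂ} (hb : 0 < b.re)
    (x : EuclideanSpace ℝ (Fin d)) :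
    ‖∫ ξ : EuclideanSpace ℝ (Fin d),
        Complex.exp (-b * ‖ξ‖ ^ 2 + Complex.I * ⟪x, ξ⟫)‖ ^ 2 ≤ (Real.pi / ‖b‖) ^ d := by
  rw [GaussianFourier.integral_cexp_neg_mul_sq_norm_add hb, norm_mul, finrank_euclideanSpace_fin]
  have h1 : ‖((Real.pi : ℂ) / b) ^ ((d : ℂ) / 2)‖ = (Real.pi / ‖b‖) ^ ((d : ℝ) / 2) := by
    have : ((d : ℂ) / 2) = (((d : ℝ) / 2 : ℝ) : ℂ) := by push_cast; ring
    rw [this, Complex.norm_cpow_real, norm_div, Complex.norm_real,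
      Real.norm_of_nonneg Real.pi_pos.le]
  have h2 : ‖Complex.exp (Complex.I ^ 2 * (‖x‖ : ℂ) ^ 2 / (4 * b))‖ ≤ 1 := by
    rw [Complex.norm_exp, Real.exp_le_one_iff]
    have : Complex.I ^ 2 * (‖x‖ : ℂ) ^ 2 / (4 * b) = ((-(‖x‖ ^ 2 / 4) : ℝ) : ℂ) * b⁻¹ := by
      rw [Complex.I_sq]; push_cast; field_simp
    rw [this, Complex.re_ofReal_mul, Complex.inv_re, neg_mul, neg_nonpos]
    have := Complex.normSq_nonneg b
    positivity
  rw [h1]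
  calc _ ≤ ((Real.pi / ‖b‖) ^ ((d : ℝ) / 2) * 1) ^ 2 := by gcongr
    _ = _ := by
      rw [mul_one, ← Real.rpow_natCast, ← Real.rpow_mul (by positivity), ← Real.rpow_natCast]
      congr 1
      push_cast
      ring

lemma integral_gaussian_mul_schwartz_eq (G : 𝓢(ℝ, ℂ)) (x : EuclideanSpace ℝ (Fin d)) :
    ∫ ξ : EuclideanSpace ℝ (Fin d),
        Complex.exp (-‖ξ‖ ^ 2 + Complex.I * ⟪x, ξ⟫) * G (‖ξ‖ ^ 2) =
      ∫ s : ℝ, 𝓕 G s * ∫ ξ : EuclideanSpace ℝ (Fin d),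
        Complex.exp (-(1 - 2 * Real.pi * s * Complex.I) * ‖ξ‖ ^ 2 + Complex.I * ⟪x, ξ⟫) := by
  have hG : ∀ ρ : ℝ, G ρ = ∫ s : ℝ, Complex.exp (2 * Real.pi * s * ρ * Complex.I) * 𝓕 G s := by
    intro ρ
    have h : 𝓕⁻ (𝓕 G) ρ = G ρ := by rw [FourierTransform.fourierInv_fourier_eq]
    rw [← h, SchwartzMap.fourierInv_coe, Real.fourierInv_eq']
    refine integral_congr_ae (.of_forall fun s => ?_)
    simp only [smul_eq_mul]
    congr 2
    simp
    ring
  have hgauss : Integrable fun ξ : EuclideanSpace ℝ (Fin d) =>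
      Complex.exp (-‖ξ‖ ^ 2 + Complex.I * ⟪x, ξ⟫) := by
    simpa using GaussianFourier.integrable_cexp_neg_mul_sq_norm_add (b := 1) (by simp) Complex.I x
  have hprod : Integrable (Function.uncurry fun (ξ : EuclideanSpace ℝ (Fin d)) (s : ℝ) =>
      Complex.exp (-‖ξ‖ ^ 2 + Complex.I * ⟪x, ξ⟫) *
        (Complex.exp (2 * Real.pi * s * (‖ξ‖ ^ 2 : ℝ) * Complex.I) * 𝓕 G s))
      (volume.prod volume) := by
    have h := hgauss.mul_prod ((𝓕 G).integrable (μ := volume))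
    refine h.mono (Continuous.aestronglyMeasurable ?_) (.of_forall fun z => ?_)
    · have := (𝓕 G).continuous
      unfold Function.uncurry
      fun_prop
    · have : (2 * Real.pi * z.2 * (‖z.1‖ ^ 2 : ℝ) * Complex.I : ℂ) =
          ((2 * Real.pi * z.2 * ‖z.1‖ ^ 2 : ℝ) : ℂ) * Complex.I := by push_cast; ring
      simp only [Function.uncurry, norm_mul, this, Complex.norm_exp_ofReal_mul_I, one_mul, le_refl]
  simp_rw [hG, ← integral_const_mul]
  rw [integral_integral_swap hprod]
  refine integral_congr_ae (.of_forall fun s => integral_congr_ae (.of_forall fun ξ => ?_))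
  simp only
  rw [← mul_assoc, ← Complex.exp_add, mul_comm]
  congr 2
  push_cast
  ring

end Gaussian

lemma eq_zero_of_not_mem_Icc {ψ : ℝ → ℝ} (hsupp : Function.support ψ ⊆ Set.Icc 1 2) {r : ℝ}
    (hr : r ∉ Set.Icc (1 : ℝ) 2) : ψ r = 0 :=
  by_contra fun h => hr (hsupp h)

lemma eq_zero_of_sqrt_not_mem {ψ : ℝ → ℝ} (hsupp : Function.support ψ ⊆ Set.Icc 1 2) {ρ : ℝ}
    (hρ : ρ ∉ Set.Icc (1 : ℝ) 4) : ψ √ρ = 0 := by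
  refine eq_zero_of_not_mem_Icc hsupp fun h => hρ ⟨?_, ?_⟩
  · simpa using h.1
  · have := (Real.sqrt_le_left (by norm_num)).1 h.2
    linarith

/-- The function of `ρ = |ξ|²` whose product with the Gaussian `e^{-ρ}` is the symbol
`ψ(|ξ|) e^{it|ξ|}`. -/
noncomputable def halfWaveProfile (ψ : ℝ → ℝ) (t ρ : ℝ) : ℂ :=
  ((ψ √ρ * Real.exp ρ : ℝ) : ℂ) * Complex.exp (Complex.I * ((t * √ρ : ℝ) : ℂ))

lemma norm_halfWaveProfile (ψ : ℝ → ℝ) (t ρ : ℝ) :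
    ‖halfWaveProfile ψ t ρ‖ = ‖ψ √ρ * Real.exp ρ‖ := by
  rw [halfWaveProfile, mul_comm Complex.I, norm_mul, Complex.norm_exp_ofReal_mul_I, mul_one,
    Complex.norm_real]

lemma halfWaveProfile_eq_zero {ψ : ℝ → ℝ} (hsupp : Function.support ψ ⊆ Set.Icc 1 2) (t : ℝ) {ρ : ℝ}
    (hρ : ρ ∉ Set.Icc (1 : ℝ) 4) : halfWaveProfile ψ t ρ = 0 := by
  simp [halfWaveProfile, eq_zero_of_sqrt_not_mem hsupp hρ]

lemma contDiff_halfWaveProfile {ψ : ℝ → ℝ} (hψ : ContDiff ℝ ∞ ψ)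
    (hsupp : Function.support ψ ⊆ Set.Icc 1 2) (t : ℝ) : ContDiff ℝ ∞ (halfWaveProfile ψ t) := by
  rw [contDiff_iff_contDiffAt]
  intro ρ
  rcases lt_or_ge ρ 1 with hρ | hρ
  · refine (contDiffAt_const (c := (0 : ℂ))).congr_of_eventuallyEq ?_
    filter_upwards [Iio_mem_nhds hρ] with y hy
    exact halfWaveProfile_eq_zero hsupp t fun h => not_lt.2 h.1 hy
  · have hs : ContDiffAt ℝ ∞ Real.sqrt ρ := Real.contDiffAt_sqrt (by positivity)
    have hψs : ContDiffAt ℝ ∞ (fun ρ => ψ √ρ) ρ := hψ.contDiffAt.comp ρ hs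
    exact (Complex.ofRealCLM.contDiff.contDiffAt.comp ρ
      (hψs.mul Real.contDiff_exp.contDiffAt)).mul
      (contDiffAt_const.mul (Complex.ofRealCLM.contDiff.contDiffAt.comp ρ
        (contDiffAt_const.mul hs))).cexp

lemma fourier_halfWaveProfile_eq {ψ : ℝ → ℝ} (hψ : ContDiff ℝ ∞ ψ)
    (hsupp : Function.support ψ ⊆ Set.Icc 1 2) {t : ℝ} (ht : t ≠ 0) (s : ℝ) :
    𝓕 (halfWaveProfile ψ t) s = ∫ r in (1 / 2 : ℝ)..3,
      quadraticPhaseIntegrand (fun r => 2 * r * (ψ r * Real.exp (r ^ 2))) 0 t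
        (2 * Real.pi * s / t) r := by
  rw [Real.fourier_real_eq_integral_exp_smul]
  set g : ℝ → ℂ := fun ρ => Complex.exp (((-2 * Real.pi * ρ * s : ℝ) : ℂ) * Complex.I) •
    halfWaveProfile ψ t ρ with hg
  have hgc : Continuous g := by
    have := (contDiff_halfWaveProfile hψ hsupp t).continuous
    fun_prop
  have hgs : Function.support g ⊆ Set.Ioc ((1 / 2 : ℝ) ^ 2) (3 ^ 2) := fun ρ hρ => by
    have : ρ ∈ Set.Icc (1 : ℝ) 4 := by_contra fun h =>
      hρ (by simp [hg, halfWaveProfile_eq_zero hsupp t h])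
    constructor <;> linarith [this.1, this.2]
  have hsub := intervalIntegral.integral_deriv_smul_comp (a := 1 / 2) (b := 3)
    (f := fun r : ℝ => r ^ 2) (f' := fun r => 2 * r) (g := g)
    (fun r _ => by simpa using hasDerivAt_pow 2 r) (by fun_prop) hgc
  rw [← intervalIntegral.integral_eq_integral_of_support_subset hgs, ← hsub]
  refine intervalIntegral.integral_congr fun r hr => ?_
  rw [Set.uIcc_of_le (by norm_num)] at hr
  have hr0 : 0 ≤ r := by linarith [hr.1]
  simp only [hg, Function.comp, halfWaveProfile, quadraticPhaseIntegrand, Real.sqrt_sq hr0,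
    smul_eq_mul, pow_zero, inv_one, Complex.ofReal_one, mul_one, Complex.real_smul]
  have hexp : Complex.exp (Complex.I * ((t * (r - 2 * Real.pi * s / t * r ^ 2) : ℝ) : ℂ)) =
      Complex.exp (((-2 * Real.pi * r ^ 2 * s : ℝ) : ℂ) * Complex.I) *
        Complex.exp (Complex.I * ((t * r : ℝ) : ℂ)) := by
    rw [← Complex.exp_add]
    congr 1
    have ht' : (t : ℂ) ≠ 0 := by exact_mod_cast ht
    push_cast
    field_simp
    ring
  rw [hexp]
  push_cast
  ring

lemma exists_norm_fourier_halfWaveProfile_le {ψ : ℝ → ℝ} (hψ : ContDiff ℝ ∞ ψ)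
    (hsupp : Function.support ψ ⊆ Set.Icc 1 2) (n : ℕ) :
    ∃ C : ℝ, 0 ≤ C ∧ ∀ t s : ℝ, t ≠ 0 → 16 * Real.pi * |s| ≤ |t| →
      ‖𝓕 (halfWaveProfile ψ t) s‖ ≤ C / |t| ^ n := by
  obtain ⟨C, hC, h⟩ := exists_norm_integral_quadraticPhaseIntegrand_le n
    (fun r => 2 * r * (ψ r * Real.exp (r ^ 2))) (by fun_prop)
    (fun r hr => hsupp fun h0 => hr (by simp [h0])) 0
  refine ⟨C, hC, fun t s ht hs => ?_⟩
  rw [fourier_halfWaveProfile_eq hψ hsupp ht]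
  refine h t _ ht ?_
  rw [abs_div, abs_mul, abs_of_pos Real.two_pi_pos, div_le_iff₀ (abs_pos.2 ht)]
  linarith

lemma one_le_norm_one_sub_mul_I (s : ℝ) : 1 ≤ ‖(1 - 2 * Real.pi * s * Complex.I : ℂ)‖ := by
  simpa using Complex.abs_re_le_norm (1 - 2 * Real.pi * s * Complex.I : ℂ)

lemma two_pi_mul_abs_le_norm_one_sub_mul_I (s : ℝ) :
    2 * Real.pi * |s| ≤ ‖(1 - 2 * Real.pi * s * Complex.I : ℂ)‖ := by
  simpa [abs_mul, abs_of_pos Real.pi_pos] using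
    Complex.abs_im_le_norm (1 - 2 * Real.pi * s * Complex.I : ℂ)

lemma pi_div_norm_one_sub_mul_I_pow_le (m : ℕ) {T s : ℝ} (hT : 0 < T)
    (hs : T < 16 * Real.pi * |s|) :
    (Real.pi / ‖(1 - 2 * Real.pi * s * Complex.I : ℂ)‖) ^ (m + 2) ≤
      Real.pi ^ (m + 2) * 8 ^ m * 128 / T ^ (m + 2) * (1 + (s / T) ^ 2)⁻¹ := by
  set b := ‖(1 - 2 * Real.pi * s * Complex.I : ℂ)‖
  have hb1 : 2 * Real.pi * |s| ≤ b := two_pi_mul_abs_le_norm_one_sub_mul_I s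
  have hbT : T / 8 ≤ b := by linarith
  have hbs : |s| ≤ b := by nlinarith [Real.pi_gt_three, abs_nonneg s]
  have hb : 0 < b := by linarith
  have hsq : (T ^ 2 + s ^ 2) / 128 ≤ b ^ 2 := by
    have h1 : (T / 8) ^ 2 ≤ b ^ 2 := by gcongr
    have h2 : s ^ 2 ≤ b ^ 2 := by rw [← sq_abs s]; gcongr
    nlinarith
  have hlow : (T / 8) ^ m * ((T ^ 2 + s ^ 2) / 128) ≤ b ^ (m + 2) := by
    rw [pow_add]; gcongr
  calc (Real.pi / b) ^ (m + 2) = Real.pi ^ (m + 2) / b ^ (m + 2) := div_pow _ _ _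
    _ ≤ Real.pi ^ (m + 2) / ((T / 8) ^ m * ((T ^ 2 + s ^ 2) / 128)) := by gcongr
    _ = _ := by
      have : T ^ 2 + s ^ 2 ≠ 0 := by positivity
      rw [div_pow T, div_pow s]
      field_simp
      ring

lemma integral_halfWave_eq {d : ℕ} {ψ : ℝ → ℝ} {t : ℝ} {G : 𝓢(ℝ, ℂ)}
    (hG : ∀ ρ, G ρ = halfWaveProfile ψ t ρ) (x : EuclideanSpace ℝ (Fin d)) :
    ∫ ξ : EuclideanSpace ℝ (Fin d),
        Complex.exp (Complex.I * ((⟪x, ξ⟫ + t * ‖ξ‖ : ℝ) : ℂ)) * (ψ ‖ξ‖ : ℂ) =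
      ∫ s : ℝ, 𝓕 G s * ∫ ξ : EuclideanSpace ℝ (Fin d),
        Complex.exp (-(1 - 2 * Real.pi * s * Complex.I) * ‖ξ‖ ^ 2 + Complex.I * ⟪x, ξ⟫) := by
  rw [← integral_gaussian_mul_schwartz_eq]
  refine integral_congr_ae (.of_forall fun ξ => ?_)
  simp only [hG, halfWaveProfile, Real.sqrt_sq (norm_nonneg ξ)]
  push_cast
  rw [show ∀ a b c e : ℂ, a * (b * c * e) = (a * c * e) * b from fun a b c e => by ring,
    ← Complex.exp_add, ← Complex.exp_add]
  congr 2
  ring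

lemma exists_norm_integral_halfWave_le {ψ : ℝ → ℝ} (hψ : ContDiff ℝ ∞ ψ)
    (hsupp : Function.support ψ ⊆ Set.Icc 1 2) (m : ℕ) :
    ∃ C : ℝ, 0 ≤ C ∧ ∀ t : ℝ, 1 ≤ |t| → ∀ x : EuclideanSpace ℝ (Fin (m + 2)),
      ‖∫ ξ : EuclideanSpace ℝ (Fin (m + 2)),
        Complex.exp (Complex.I * ((⟪x, ξ⟫ + t * ‖ξ‖ : ℝ) : ℂ)) * (ψ ‖ξ‖ : ℂ)‖ ≤
        C * |t|⁻¹ ^ (((m : ℝ) + 1) / 2) := by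
  obtain ⟨C, hC, hlow⟩ := exists_norm_fourier_halfWaveProfile_le hψ hsupp (m + 2)
  set E : ℝ := ∫ ρ : ℝ, ‖ψ √ρ * Real.exp ρ‖ ^ 2
  set M : ℝ := 1 + Real.pi ^ (m + 2) with hM
  set D : ℝ := Real.pi ^ (m + 2) * 8 ^ m * 128 with hD
  have hE : 0 ≤ E := integral_nonneg fun ρ => by positivity
  have hpi := Real.pi_pos
  refine ⟨E + 2 * C * M * Real.pi + D * Real.pi, by positivity, fun t ht x => ?_⟩
  set T := |t|
  have hT : 0 < T := by linarith
  set l := T⁻¹ ^ (((m : ℝ) + 1) / 2) with hl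
  have hl0 : 0 < l := by positivity
  have hl1 : l ≤ 1 := Real.rpow_le_one (by positivity) (inv_le_one_of_one_le₀ ht) (by positivity)
  have hlsq : l ^ 2 = T / T ^ (m + 2) := by
    rw [hl, ← Real.rpow_natCast, ← Real.rpow_mul (by positivity)]
    have : ((m : ℝ) + 1) / 2 * (2 : ℕ) = ((m + 1 : ℕ) : ℝ) := by push_cast; ring
    rw [this, Real.rpow_natCast, inv_pow]
    field_simp
    ring
  let G : 𝓢(ℝ, ℂ) := HasCompactSupport.toSchwartzMap (f := halfWaveProfile ψ t)
    (HasCompactSupport.intro isCompact_Icc fun ρ hρ => halfWaveProfile_eq_zero hsupp t hρ)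
    (contDiff_halfWaveProfile hψ hsupp t)
  have hG : ∀ ρ, G ρ = halfWaveProfile ψ t ρ := fun ρ => rfl
  rw [integral_halfWave_eq hG]
  set K : ℝ → ℂ := fun s => ∫ ξ : EuclideanSpace ℝ (Fin (m + 2)),
        Complex.exp (-(1 - 2 * Real.pi * s * Complex.I) * ‖ξ‖ ^ 2 + Complex.I * ⟪x, ξ⟫)
  have hK : ∀ s, ‖K s‖ ^ 2 ≤
      (Real.pi / ‖(1 - 2 * Real.pi * s * Complex.I : ℂ)‖) ^ (m + 2) := fun s =>
    sq_norm_integral_cexp_neg_mul_sq_norm_add_le (by simp) x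
  have hpt : ∀ s, ‖𝓕 G s * K s‖ ≤ l * ‖𝓕 G s‖ ^ 2 +
      (2 * C * M / T ^ (m + 2) + l⁻¹ * (D / T ^ (m + 2))) * (1 + (s / T) ^ 2)⁻¹ := by
    intro s
    rw [norm_mul]
    rcases le_or_gt (16 * Real.pi * |s|) T with hs | hs
    · have h1 : ‖𝓕 G s‖ ≤ C / T ^ (m + 2) := hlow t s (abs_pos.1 hT) hs
      have h2 : ‖K s‖ ≤ M := by
        have : (Real.pi / ‖(1 - 2 * Real.pi * s * Complex.I : ℂ)‖) ^ (m + 2) ≤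
            Real.pi ^ (m + 2) := by
          gcongr
          exact div_le_self hpi.le (one_le_norm_one_sub_mul_I s)
        nlinarith [hK s, sq_nonneg (‖K s‖ - 1)]
      have h3 : 1 ≤ 2 * (1 + (s / T) ^ 2)⁻¹ := by
        have : (s / T) ^ 2 ≤ 1 := by
          rw [sq_le_one_iff_abs_le_one, abs_div, abs_of_pos hT, div_le_one hT]
          nlinarith [Real.pi_gt_three, abs_nonneg s]
        rw [← div_eq_mul_inv, le_div_iff₀ (by positivity)]
        linarith
      calc ‖𝓕 G s‖ * ‖K s‖ ≤ C / T ^ (m + 2) * M := by gcongr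
        _ ≤ C / T ^ (m + 2) * M * (2 * (1 + (s / T) ^ 2)⁻¹) :=
            le_mul_of_one_le_right (by positivity) h3
        _ = 0 + (2 * C * M / T ^ (m + 2) + 0) * (1 + (s / T) ^ 2)⁻¹ := by ring
        _ ≤ _ := by gcongr <;> positivity
    · have h1 : ‖𝓕 G s‖ * ‖K s‖ ≤ l * ‖𝓕 G s‖ ^ 2 + l⁻¹ * ‖K s‖ ^ 2 := by
        have h := two_mul_le_add_sq (l * ‖𝓕 G s‖) ‖K s‖
        have h' : 0 ≤ l * ‖𝓕 G s‖ * ‖K s‖ := by positivity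
        calc ‖𝓕 G s‖ * ‖K s‖ = l⁻¹ * (l * ‖𝓕 G s‖ * ‖K s‖) := by field_simp
          _ ≤ l⁻¹ * ((l * ‖𝓕 G s‖) ^ 2 + ‖K s‖ ^ 2) := by gcongr; linarith
          _ = _ := by field_simp
      have h2 := (hK s).trans (pi_div_norm_one_sub_mul_I_pow_le m hT hs)
      calc ‖𝓕 G s‖ * ‖K s‖ ≤ l * ‖𝓕 G s‖ ^ 2 +
            l⁻¹ * (D / T ^ (m + 2) * (1 + (s / T) ^ 2)⁻¹) := h1.trans (by gcongr)
        _ = l * ‖𝓕 G s‖ ^ 2 + (0 + l⁻¹ * (D / T ^ (m + 2))) * (1 + (s / T) ^ 2)⁻¹ := by ring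
        _ ≤ _ := by gcongr; positivity
  have hL2 : Integrable fun s => ‖𝓕 G s‖ ^ 2 :=
    ((𝓕 G).memLp 2 volume).integrable_norm_pow (by norm_num)
  have hcauchy : Integrable fun s : ℝ => (1 + (s / T) ^ 2)⁻¹ :=
    integrable_inv_one_add_sq.comp_div hT.ne'
  have hPlancherel : ∫ s, ‖𝓕 G s‖ ^ 2 = E := by
    rw [SchwartzMap.integral_norm_sq_fourier]
    simp only [hG, norm_halfWaveProfile, E]
  have hcauchyInt : ∫ s : ℝ, (1 + (s / T) ^ 2)⁻¹ = T * Real.pi := by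
    rw [Measure.integral_comp_div (fun s : ℝ => (1 + s ^ 2)⁻¹) T, integral_univ_inv_one_add_sq,
      abs_of_pos hT, smul_eq_mul]
  refine (norm_integral_le_of_norm_le ((hL2.const_mul _).add (hcauchy.const_mul _))
    (.of_forall hpt)).trans ?_
  simp only [Pi.add_apply]
  rw [integral_add (hL2.const_mul _) (hcauchy.const_mul _), integral_const_mul, integral_const_mul,
    hPlancherel, hcauchyInt]
  calc l * E + (2 * C * M / T ^ (m + 2) + l⁻¹ * (D / T ^ (m + 2))) * (T * Real.pi)
      = l * E + (2 * C * M * Real.pi) * (T / T ^ (m + 2)) +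
          l⁻¹ * D * Real.pi * (T / T ^ (m + 2)) := by ring
    _ = l * E + (2 * C * M * Real.pi) * (l * l) + D * Real.pi * l := by
        rw [← hlsq]; field_simp
    _ ≤ l * E + (2 * C * M * Real.pi) * (1 * l) + D * Real.pi * l := by gcongr
    _ = _ := by ring

lemma norm_integral_halfWave_le (d : ℕ) (ψ : ℝ → ℝ) (t : ℝ) (x : EuclideanSpace ℝ (Fin d)) :
    ‖∫ ξ : EuclideanSpace ℝ (Fin d),
        Complex.exp (Complex.I * ((⟪x, ξ⟫ + t * ‖ξ‖ : ℝ) : ℂ)) * (ψ ‖ξ‖ : ℂ)‖ ≤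
      ∫ ξ : EuclideanSpace ℝ (Fin d), ‖ψ ‖ξ‖‖ := by
  refine (norm_integral_le_integral_norm _).trans_eq
    (integral_congr_ae (.of_forall fun ξ => ?_))
  simp only [norm_mul, mul_comm Complex.I, Complex.norm_exp_ofReal_mul_I, one_mul,
    Complex.norm_real]

lemma integral_halfWave_rescale (d : ℕ) (ψ : ℝ → ℝ) {h : ℝ} (hh : 0 < h) (t : ℝ)
    (x : EuclideanSpace ℝ (Fin d)) :
    ∫ ξ : EuclideanSpace ℝ (Fin d),
        Complex.exp (Complex.I * ((⟪x, ξ⟫ + t * ‖ξ‖ : ℝ) : ℂ)) * (ψ (h * ‖ξ‖) : ℂ) =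
      h ^ (-(d : ℤ)) • ∫ ξ : EuclideanSpace ℝ (Fin d),
        Complex.exp (Complex.I * ((⟪h⁻¹ • x, ξ⟫ + t / h * ‖ξ‖ : ℝ) : ℂ)) * (ψ ‖ξ‖ : ℂ) := by
  have := Measure.integral_comp_smul_of_nonneg volume (fun ξ : EuclideanSpace ℝ (Fin d) =>
    Complex.exp (Complex.I * ((⟪h⁻¹ • x, ξ⟫ + t / h * ‖ξ‖ : ℝ) : ℂ)) * (ψ ‖ξ‖ : ℂ)) h (hR := hh.le)
  rw [finrank_euclideanSpace_fin] at this
  rw [zpow_neg, zpow_natCast, ← this]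
  refine integral_congr_ae (.of_forall fun ξ => ?_)
  simp only [norm_smul, Real.norm_of_nonneg hh.le, real_inner_smul_left, real_inner_smul_right]
  congr 5 <;> field_simp

/-- Semiclassical dispersive estimate for the half-wave propagator. -/
theorem semiclassical_dispersive_estimate
    (d : ℕ) (hd : 1 ≤ d) (ψ : ℝ → ℝ)
    (hψ : ContDiff ℝ (⊤ : ℕ∞) ψ) (hψc : HasCompactSupport ψ)
    (hsupp : Function.support ψ ⊆ {r : ℝ | 1 ≤ r ∧ r ≤ 2}) :
    ∃ C : ℝ, 0 < C ∧ ∀ h : ℝ, 0 < h → ∀ t : ℝ, t ≠ 0 → ∀ x : EuclideanSpace ℝ (Fin d),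
      ‖∫ ξ : EuclideanSpace ℝ (Fin d),
          Complex.exp (Complex.I * ((⟪x, ξ⟫ + t * ‖ξ‖ : ℝ) : ℂ)) * (ψ (h * ‖ξ‖) : ℂ)‖
        ≤ C * h ^ (-(d : ℤ)) * min 1 ((h / |t|) ^ (((d : ℝ) - 1) / 2)) := by
  set C₀ : ℝ := ∫ ξ : EuclideanSpace ℝ (Fin d), ‖ψ ‖ξ‖‖
  have hC₀ : 0 ≤ C₀ := integral_nonneg fun ξ => norm_nonneg _
  obtain ⟨C₁, hC₁, hdecay⟩ : ∃ C : ℝ, 0 ≤ C ∧ ∀ t : ℝ, 1 ≤ |t| →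
      ∀ x : EuclideanSpace ℝ (Fin d),
      ‖∫ ξ : EuclideanSpace ℝ (Fin d),
        Complex.exp (Complex.I * ((⟪x, ξ⟫ + t * ‖ξ‖ : ℝ) : ℂ)) * (ψ ‖ξ‖ : ℂ)‖ ≤
        C * |t|⁻¹ ^ (((d : ℝ) - 1) / 2) := by
    obtain rfl | ⟨m, rfl⟩ : d = 1 ∨ ∃ m, d = m + 2 := by
      rcases hd.eq_or_lt with h | h
      · exact .inl h.symm
      · exact .inr ⟨d - 2, by omega⟩
    · exact ⟨C₀, hC₀, fun t _ x =>
        (norm_integral_halfWave_le 1 ψ t x).trans_eq (by simp [C₀])⟩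
    · have hexp : (((m + 2 : ℕ) : ℝ) - 1) / 2 = ((m : ℝ) + 1) / 2 := by push_cast; ring
      rw [hexp]
      exact exists_norm_integral_halfWave_le hψ hsupp m
  refine ⟨C₀ + C₁ + 1, by positivity, fun h hh t ht x => ?_⟩
  have hexp : 0 ≤ ((d : ℝ) - 1) / 2 := by
    have : (1 : ℝ) ≤ d := by exact_mod_cast hd
    linarith
  have ht' : 0 < |t| := abs_pos.2 ht
  have hquot : h / |t| = |t / h|⁻¹ := by rw [abs_div, abs_of_pos hh, inv_div]
  rw [integral_halfWave_rescale d ψ hh, norm_smul, Real.norm_of_nonneg (by positivity),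
    mul_comm (C₀ + C₁ + 1), mul_assoc]
  gcongr
  have htriv := norm_integral_halfWave_le d ψ (t / h) (h⁻¹ • x)
  have hone : C₀ ≤ (C₀ + C₁ + 1) * 1 := by linarith
  rw [mul_min_of_nonneg _ _ (by positivity)]
  refine le_min (htriv.trans hone) ?_
  rcases le_total 1 |t / h| with h1 | h1
  · refine (hdecay (t / h) h1 _).trans ?_
    rw [hquot]
    gcongr
    linarith
  · refine htriv.trans (hone.trans ?_)
    gcongr
    refine Real.one_le_rpow ?_ hexp
    rw [hquot]
    exact (one_le_inv₀ (by positivity)).2 h1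
end

section
/- Let a > 1, t₀ ∈ ℝ and T ∈ (t₀, ∞]. Suppose y : [t₀, T) → ℝ is twice differentiable with y(t) > 0 for all t ∈ [t₀,T), y'(t₀) > 0, and y(t) y''(t) ≥ a (y'(t))² for all t ∈ [t₀, T). Then T is finite; more precisely T ≤ t₀ + y(t₀) / ((a−1) y'(t₀)). -/
/-- If `y > 0` and `y y'' ≥ a (y')²` on `[t₀, t₁]`, then `y' y^{-a}` is nondecreasing there. -/
theorem monotoneOn_mul_rpow_neg_of_mul_sq_le {a t₀ t₁ : ℝ} {y y' y'' : ℝ → ℝ}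
    (hy : ∀ t ∈ Set.Icc t₀ t₁, HasDerivWithinAt y (y' t) (Set.Icc t₀ t₁) t)
    (hy' : ∀ t ∈ Set.Icc t₀ t₁, HasDerivWithinAt y' (y'' t) (Set.Icc t₀ t₁) t)
    (hpos : ∀ t ∈ Set.Icc t₀ t₁, 0 < y t)
    (hineq : ∀ t ∈ Set.Icc t₀ t₁, a * y' t ^ 2 ≤ y t * y'' t) :
    MonotoneOn (fun t => y' t * y t ^ (-a)) (Set.Icc t₀ t₁) := by
  have hderiv : ∀ t ∈ Set.Icc t₀ t₁, HasDerivWithinAt (fun t => y' t * y t ^ (-a))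
      (y'' t * y t ^ (-a) + y' t * (y' t * -a * y t ^ (-a - 1))) (Set.Icc t₀ t₁) t :=
    fun t ht => (hy' t ht).mul ((hy t ht).rpow_const (Or.inl (hpos t ht).ne'))
  refine monotoneOn_of_hasDerivWithinAt_nonneg (convex_Icc t₀ t₁)
    (fun t ht => (hderiv t ht).continuousWithinAt)
    (fun t ht => (hderiv t (interior_subset ht)).mono interior_subset) fun t ht => ?_
  have hyt := hpos t (interior_subset ht)
  have hsplit : y t ^ (-a) = y t ^ (-a - 1) * y t := by
    rw [← Real.rpow_add_one hyt.ne', sub_add_cancel]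
  have hprod := mul_nonneg (Real.rpow_nonneg hyt.le (-a - 1))
    (sub_nonneg.2 (hineq t (interior_subset ht)))
  rw [hsplit]
  linarith

/-- If `y > 0` and `y y'' ≥ a (y')²` on `[t₀, t₁]` with `a > 1`, then `y^{1-a}` lies below its
tangent line at `t₀`, whose positivity at `t₁` bounds the length of the interval. -/
theorem mul_sub_lt_of_mul_sq_le {a t₀ t₁ : ℝ} (ha : 1 < a) (hle : t₀ ≤ t₁) {y y' y'' : ℝ → ℝ}
    (hy : ∀ t ∈ Set.Icc t₀ t₁, HasDerivWithinAt y (y' t) (Set.Icc t₀ t₁) t)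
    (hy' : ∀ t ∈ Set.Icc t₀ t₁, HasDerivWithinAt y' (y'' t) (Set.Icc t₀ t₁) t)
    (hpos : ∀ t ∈ Set.Icc t₀ t₁, 0 < y t)
    (hineq : ∀ t ∈ Set.Icc t₀ t₁, a * y' t ^ 2 ≤ y t * y'' t) :
    (a - 1) * y' t₀ * (t₁ - t₀) < y t₀ := by
  have hleft : t₀ ∈ Set.Icc t₀ t₁ := Set.left_mem_Icc.2 hle
  have hright : t₁ ∈ Set.Icc t₀ t₁ := Set.right_mem_Icc.2 hle
  have hmono := monotoneOn_mul_rpow_neg_of_mul_sq_le hy hy' hpos hineq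
  set c : ℝ := (a - 1) * (y' t₀ * y t₀ ^ (-a)) with hc
  have hderiv : ∀ t ∈ Set.Icc t₀ t₁, HasDerivWithinAt (fun t => y t ^ (1 - a) + c * t)
      (y' t * (1 - a) * y t ^ (1 - a - 1) + c * 1) (Set.Icc t₀ t₁) t :=
    fun t ht => ((hy t ht).rpow_const (Or.inl (hpos t ht).ne')).add
      ((hasDerivWithinAt_id t _).const_mul c)
  have hanti : AntitoneOn (fun t => y t ^ (1 - a) + c * t) (Set.Icc t₀ t₁) := by
    refine antitoneOn_of_hasDerivWithinAt_nonpos (convex_Icc t₀ t₁)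
      (fun t ht => (hderiv t ht).continuousWithinAt)
      (fun t ht => (hderiv t (interior_subset ht)).mono interior_subset) fun t ht => ?_
    have htI := interior_subset ht
    have hslope := mul_le_mul_of_nonneg_left (hmono hleft htI htI.1) (sub_nonneg.2 ha.le)
    rw [show 1 - a - 1 = -a by ring, hc]
    linarith
  have hend := hanti hleft hright hle
  have hy₀ := hpos t₀ hleft
  have hsplit : y t₀ ^ (1 - a) = y t₀ ^ (-a) * y t₀ := by
    rw [← Real.rpow_add_one hy₀.ne', neg_add_eq_sub]
  have hend_pos := Real.rpow_pos_of_pos (hpos t₁ hright) (1 - a)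
  simp only [hsplit, hc] at hend
  refine lt_of_mul_lt_mul_left ?_ (Real.rpow_nonneg hy₀.le (-a))
  linarith

/-- Concavity/differential-inequality blow-up lemma: if `y > 0`, `y'(t₀) > 0` and
`y y'' ≥ a (y')²` with `a > 1` on `[t₀, T)`, then `T` is finite and in fact
`T ≤ t₀ + y(t₀) / ((a-1) y'(t₀))`. -/
theorem ode_blowup_lemma (a t₀ : ℝ) (ha : 1 < a) (T : EReal) (hT : (t₀ : EReal) < T)
    (y y' y'' : ℝ → ℝ)
    (hy : ∀ t : ℝ, t₀ ≤ t → (t : EReal) < T →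
      HasDerivWithinAt y (y' t) {s : ℝ | t₀ ≤ s ∧ (s : EReal) < T} t)
    (hy' : ∀ t : ℝ, t₀ ≤ t → (t : EReal) < T →
      HasDerivWithinAt y' (y'' t) {s : ℝ | t₀ ≤ s ∧ (s : EReal) < T} t)
    (hpos : ∀ t : ℝ, t₀ ≤ t → (t : EReal) < T → 0 < y t)
    (hy'0 : 0 < y' t₀)
    (hineq : ∀ t : ℝ, t₀ ≤ t → (t : EReal) < T → a * (y' t) ^ 2 ≤ y t * y'' t) :
    T ≠ ⊤ ∧ T ≤ ((t₀ + y t₀ / ((a - 1) * y' t₀) : ℝ) : EReal) := by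
  suffices hbound : T ≤ ((t₀ + y t₀ / ((a - 1) * y' t₀) : ℝ) : EReal) from
    ⟨(hbound.trans_lt (EReal.coe_lt_top _)).ne, hbound⟩
  by_contra! hlt
  have hslope : 0 < (a - 1) * y' t₀ := mul_pos (sub_pos.2 ha) hy'0
  set t₁ : ℝ := t₀ + y t₀ / ((a - 1) * y' t₀) with ht₁
  have hle : t₀ ≤ t₁ := le_add_of_nonneg_right (div_pos (hpos t₀ le_rfl hT) hslope).le
  have hsub : ∀ t ∈ Set.Icc t₀ t₁, t₀ ≤ t ∧ (t : EReal) < T :=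
    fun t ht => ⟨ht.1, (EReal.coe_le_coe_iff.2 ht.2).trans_lt hlt⟩
  have hlength := mul_sub_lt_of_mul_sq_le ha hle
    (fun t ht => (hy t (hsub t ht).1 (hsub t ht).2).mono hsub)
    (fun t ht => (hy' t (hsub t ht).1 (hsub t ht).2).mono hsub)
    (fun t ht => hpos t (hsub t ht).1 (hsub t ht).2)
    (fun t ht => hineq t (hsub t ht).1 (hsub t ht).2)
  rw [ht₁, add_sub_cancel_left, mul_div_cancel₀ _ hslope.ne'] at hlength
  exact hlength.false
end
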